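/- arXiv:2511.17912 — 2 statements merged into one kernel-verified Lean document; each statement's English description precedes it below -/
import Mathlib

section
/- Let F ⊆ binom([n], k) be a (c,s)-frameproof hypergraph, t = ⌈sk/c⌉, and let λ ∈ [c] satisfy λ ≡ sk (mod c). Let F_0 be the set of edges A ∈ F that have no own (t-1)-subset with respect to F. Then every A ∈ F_0 contains at least binom(k,t) - m(k,t,λ; s+1, c-s+1) own t-subsets with respect to F. -/
/-- A hypergraph `F` on `Fin n` is (c,s)-frameproof: for every `A₀ ∈ F` and every
collection `A₁,…,A_c ∈ F` (repeats allowed) with `Aⱼ ≠ A₀`, some vertex `i ∈ A₀`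
lies in fewer than `s` of the `Aⱼ`. -/
def IsFrameproof {n : ℕ} (c s : ℕ) (F : Finset (Finset (Fin n))) : Prop :=
  ∀ A0 ∈ F, ∀ A : Fin c → Finset (Fin n),
    (∀ j, A j ∈ F) → (∀ j, A j ≠ A0) →
    ∃ i ∈ A0, (Finset.univ.filter (fun j => i ∈ A j)).card < s

/-- `T` is an own subset of `A` with respect to `F`: no other member of `F` contains `T`. -/
def IsOwnSubset {n : ℕ} (F : Finset (Finset (Fin n))) (A T : Finset (Fin n)) : Prop :=
  T ⊆ A ∧ ∀ B ∈ F, B ≠ A → ¬ T ⊆ B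

instance {n : ℕ} (F : Finset (Finset (Fin n))) (A T : Finset (Fin n)) :
    Decidable (IsOwnSubset F A T) := by
  unfold IsOwnSubset; infer_instance

/-- The generalized matching number `m(n,t,λ;k₁,k₂)`: the maximum size of a family of
`t`-subsets of `[n]` containing no (k₁,k₂)-disjoint collection of `λ` repeatable members. -/
noncomputable def genMatch (n t lam k1 k2 : ℕ) : ℕ :=
  sSup {N | ∃ G : Finset (Finset (Fin n)),
    (∀ S ∈ G, S.card = t) ∧
    (¬ ∃ A : Fin lam → Finset (Fin n), (∀ i, A i ∈ G) ∧
      (∀ B : Finset (Fin lam), B.card = k1 → B.inf A = ∅) ∧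
      (∀ B : Finset (Fin lam), B.card = k2 → B.sup A = Finset.univ)) ∧
    G.card = N}

/-- Degree sequences bounded by `m` with sum `a * m` are realised by `m` sets of size `a`. -/
theorem deg_realise {ι : Type*} [Fintype ι] [DecidableEq ι] (a m : ℕ) (r : ι → ℕ)
    (hr : ∀ i, r i ≤ m) (hsum : ∑ i, r i = a * m) :
    ∃ S : Fin m → Finset ι, (∀ j, (S j).card = a) ∧
      ∀ i, (∑ j, if i ∈ S j then 1 else 0) = r i := by
  induction m generalizing r with
  | zero =>
    refine ⟨fun j => j.elim0, fun j => j.elim0, fun i => ?_⟩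
    have := hr i
    simp
    omega
  | succ m ih =>
    have h1 : (Finset.univ.filter (fun i => r i = m + 1)).card ≤ a := by
      have : (Finset.univ.filter (fun i => r i = m + 1)).card * (m + 1) ≤ a * (m + 1) := by
        rw [← hsum, Finset.card_filter, Finset.sum_mul]
        apply Finset.sum_le_sum
        intro i _
        split_ifs <;> omega
      exact Nat.le_of_mul_le_mul_right this (Nat.succ_pos m)
    have h2 : a ≤ (Finset.univ.filter (fun i => 0 < r i)).card := by
      have : a * (m + 1) ≤ (Finset.univ.filter (fun i => 0 < r i)).card * (m + 1) := by
        rw [← hsum, Finset.card_filter, Finset.sum_mul]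
        apply Finset.sum_le_sum
        intro i _
        have := hr i
        split_ifs <;> omega
      exact Nat.le_of_mul_le_mul_right this (Nat.succ_pos m)
    obtain ⟨S, hS1, hS2, hS3⟩ := Finset.exists_subsuperset_card_eq
      (s := Finset.univ.filter (fun i => r i = m + 1))
      (t := Finset.univ.filter (fun i => 0 < r i)) (n := a)
      (by intro i; simp; omega) h1 h2
    have hin : ∀ i, r i = m + 1 → i ∈ S := fun i hi => hS1 (by simp [hi])
    have hpos : ∀ i ∈ S, 0 < r i := fun i hi => by simpa using hS2 hi
    have hdec : ∀ i, r i = (r i - if i ∈ S then 1 else 0) + if i ∈ S then 1 else 0 := by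
      intro i
      by_cases h : i ∈ S
      · have := hpos i h
        simp [h]; omega
      · simp [h]
    obtain ⟨S', hc', hd'⟩ := ih (fun i => r i - if i ∈ S then 1 else 0) (by
        intro i
        have := hr i
        by_cases h : i ∈ S
        · simp [h]; omega
        · have : r i ≠ m + 1 := fun h' => h (hin i h')
          simp [h]; omega) (by
        have h3 : ∑ i, r i = ∑ i, (r i - if i ∈ S then 1 else 0)
            + ∑ i, (if i ∈ S then 1 else 0) := by
          rw [← Finset.sum_add_distrib]
          exact Finset.sum_congr rfl (fun i _ => hdec i)
        have h4 : ∑ i, (if i ∈ S then 1 else 0) = a := by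
          simp [hS3]
        rw [hsum, h4, Nat.mul_succ] at h3
        omega)
    refine ⟨Fin.cons S S', ?_, ?_⟩
    · intro j
      refine Fin.cases ?_ ?_ j
      · simpa using hS3
      · intro j; simpa using hc' j
    · intro i
      rw [Fin.sum_univ_succ]
      simp only [Fin.cons_zero, Fin.cons_succ]
      rw [hd' i]
      have := hdec i
      omega

theorem arith_aux (N c t lam : ℕ) (hc : 2 ≤ c) (hN : 1 ≤ N)
    (ht : t = (N + c - 1) / c) (hlam1 : 1 ≤ lam) (hlam2 : lam ≤ c)
    (hmod : lam % c = N % c) : 1 ≤ t ∧ N = (t - 1) * c + lam := by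
  have hd := Nat.div_add_mod N c
  rcases Nat.lt_or_ge lam c with h | h
  · rw [Nat.mod_eq_of_lt h] at hmod
    have : t = N / c + 1 := by
      rw [ht, Nat.div_eq_iff (by omega)]
      have : (N / c + 1) * c = c * (N / c) + c := by ring
      omega
    rw [this]
    refine ⟨Nat.succ_pos _, ?_⟩
    rw [Nat.add_sub_cancel, mul_comm]
    omega
  · have h' : lam = c := le_antisymm hlam2 h
    subst h'
    rw [Nat.mod_self] at hmod
    have : t = N / lam := by
      rw [ht, Nat.div_eq_iff (by omega)]
      have : (N / lam) * lam = lam * (N / lam) := by ring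
      omega
    rw [← this] at hd
    have h1 : 1 ≤ t := by
      rcases Nat.eq_zero_or_pos t with h0 | h0
      · rw [h0] at hd; omega
      · exact h0
    refine ⟨h1, ?_⟩
    obtain ⟨u, rfl⟩ := Nat.exists_eq_add_of_le h1
    rw [Nat.add_sub_cancel_left]
    have : lam * (1 + u) = u * lam + lam := by ring
    omega

theorem core_aux (n k lam m s t : ℕ) (hs1 : 1 ≤ s) (hs2 : s ≤ lam + m)
    (ht : 1 ≤ t) (hN : s * k = (t - 1) * (lam + m) + lam)
    (F : Finset (Finset (Fin n))) (hfp : IsFrameproof (lam + m) s F)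
    (A : Finset (Fin n)) (hA : A ∈ F)
    (hnoown : ∀ T : Finset (Fin n), T.card = t - 1 → ¬ IsOwnSubset F A T)
    (f : Fin k ↪ Fin n) (hf : Finset.univ.map f = A)
    (T : Fin lam → Finset (Fin k)) (hT : ∀ j, (T j).card = t)
    (hTown : ∀ j, ¬ IsOwnSubset F A ((T j).map f))
    (h1 : ∀ B : Finset (Fin lam), B.card = s + 1 → B.inf T = ∅)
    (h2 : ∀ B : Finset (Fin lam), B.card = lam + m - s + 1 → B.sup T = Finset.univ) :
    False := by
  have hsub : ∀ S : Finset (Fin k), S.map f ⊆ A := fun S => by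
    rw [← hf]; exact Finset.map_subset_map.2 (Finset.subset_univ S)
  have hex : ∀ S : Finset (Fin k), ¬ IsOwnSubset F A (S.map f) →
      ∃ B ∈ F, B ≠ A ∧ S.map f ⊆ B := by
    intro S hS
    by_contra hcon
    exact hS ⟨hsub S, fun B hB hne hle => hcon ⟨B, hB, hne, hle⟩⟩
  let d : Fin k → ℕ := fun i => ∑ j, if i ∈ T j then 1 else 0
  have hd : ∀ i, d i = (Finset.univ.filter (fun j => i ∈ T j)).card := fun i => by
    rw [Finset.card_filter]
  have hup : ∀ i, d i ≤ s := by
    intro i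
    by_contra hcon
    rw [hd] at hcon
    obtain ⟨B, hB, hBc⟩ := Finset.exists_subset_card_eq (n := s + 1)
      (s := Finset.univ.filter (fun j => i ∈ T j)) (by omega)
    have hi : i ∈ B.inf T := by
      rw [Finset.mem_inf]
      intro j hj
      simpa using hB hj
    rw [h1 B hBc] at hi
    simp at hi
  have hlow : ∀ i, s ≤ d i + m := by
    intro i
    by_contra hcon
    rw [hd] at hcon
    have hcard := Finset.card_filter_add_card_filter_not (s := (Finset.univ : Finset (Fin lam)))
      (fun j => i ∈ T j)
    rw [Finset.card_univ, Fintype.card_fin] at hcard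
    obtain ⟨B, hB, hBc⟩ := Finset.exists_subset_card_eq (n := lam + m - s + 1)
      (s := Finset.univ.filter (fun j => ¬ i ∈ T j)) (by omega)
    have hi : i ∈ B.sup T := by
      rw [h2 B hBc]; simp
    rw [Finset.mem_sup] at hi
    obtain ⟨j, hj, hij⟩ := hi
    have := hB hj
    simp at this
    exact this hij
  have hdsum : ∑ i, d i = lam * t := by
    rw [Finset.sum_comm]
    simp [hT]
  obtain ⟨S, hSc, hSd⟩ := deg_realise (t - 1) m (fun i => s - d i)
    (fun i => by have := hlow i; omega) (by
      have e : ∑ i, (s - d i) + ∑ i, d i = s * k := by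
        rw [← Finset.sum_add_distrib]
        rw [Finset.sum_congr rfl (fun i _ => Nat.sub_add_cancel (hup i))]
        simp [mul_comm]
      rw [hdsum, hN] at e
      obtain ⟨u, rfl⟩ := Nat.exists_eq_add_of_le ht
      rw [Nat.add_sub_cancel_left] at e ⊢
      have : u * (lam + m) + lam = u * m + lam * (1 + u) := by ring
      omega)
  choose B1 hB1 hB1n hB1s using fun j => hex (T j) (hTown j)
  choose B2 hB2 hB2n hB2s using fun j => hex (S j) (hnoown _ (by rw [Finset.card_map, hSc j]))
  obtain ⟨v, hv, hlt⟩ := hfp A hA (Fin.append B1 B2)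
    (fun j => by refine Fin.addCases ?_ ?_ j <;> intro j <;> simp [hB1, hB2])
    (fun j => by refine Fin.addCases ?_ ?_ j <;> intro j <;> simp [hB1n, hB2n])
  rw [← hf, Finset.mem_map] at hv
  obtain ⟨i, -, rfl⟩ := hv
  rw [Finset.card_filter, Fin.sum_univ_add] at hlt
  simp only [Fin.append_left, Fin.append_right] at hlt
  have e1 : d i ≤ ∑ j, if f i ∈ B1 j then 1 else 0 := by
    apply Finset.sum_le_sum
    intro j _
    by_cases h : i ∈ T j
    · have := hB1s j (Finset.mem_map_of_mem f h)
      simp [this]; split_ifs <;> omega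
    · simp [h]
  have e2 : s - d i ≤ ∑ j, if f i ∈ B2 j then 1 else 0 := by
    rw [← hSd i]
    apply Finset.sum_le_sum
    intro j _
    by_cases h : i ∈ S j
    · have := hB2s j (Finset.mem_map_of_mem f h)
      simp [this]; split_ifs <;> omega
    · simp [h]
  omega

/-- In a (c,s)-frameproof `k`-uniform hypergraph `F ⊆ binom([n],k)`, every
edge with no own `(t-1)`-subset has at least `binom(k,t) - m(k,t,λ;s+1,c-s+1)` own
`t`-subsets, where `t = ⌈sk/c⌉` and `λ ∈ [c]`, `λ ≡ sk (mod c)`. -/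
theorem stmt5 (n k c s t lam : ℕ) (hnk : k ≤ n) (hk : 2 ≤ k)
    (hc : 2 ≤ c) (hs1 : 1 ≤ s) (hs2 : s ≤ c - 1)
    (ht : t = (s * k + c - 1) / c)
    (hlam1 : 1 ≤ lam) (hlam2 : lam ≤ c) (hmod : lam % c = (s * k) % c)
    (F : Finset (Finset (Fin n))) (huniform : ∀ A ∈ F, A.card = k)
    (hfp : IsFrameproof c s F)
    (A : Finset (Fin n)) (hA : A ∈ F)
    (hnoown : ∀ T : Finset (Fin n), T.card = t - 1 → ¬ IsOwnSubset F A T) :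
    Nat.choose k t - genMatch k t lam (s + 1) (c - s + 1) ≤
      ((A.powersetCard t).filter (fun T => IsOwnSubset F A T)).card := by
  obtain ⟨ht1, hN⟩ := arith_aux (s * k) c t lam hc (by nlinarith) ht hlam1 hlam2 hmod
  obtain ⟨m, rfl⟩ := Nat.exists_eq_add_of_le hlam2
  let f : Fin k ↪ Fin n := (A.orderEmbOfFin (huniform A hA)).toEmbedding
  have hf : Finset.univ.map f = A := Finset.map_orderEmbOfFin_univ A (huniform A hA)
  let P := (Finset.univ : Finset (Fin k)).powersetCard t
  let G := P.filter (fun S => ¬ IsOwnSubset F A (S.map f))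
  have hG : G.card ≤ genMatch k t lam (s + 1) (lam + m - s + 1) := by
    apply le_csSup
    · refine ⟨Fintype.card (Finset (Fin k)), ?_⟩
      rintro N ⟨H, -, -, rfl⟩
      exact Finset.card_le_univ H
    · refine ⟨G, ?_, ?_, rfl⟩
      · intro S hS
        exact (Finset.mem_powersetCard.1 (Finset.mem_filter.1 hS).1).2
      · rintro ⟨T, hTG, h1, h2⟩
        exact core_aux n k lam m s t hs1 (by omega) ht1 hN F hfp A hA hnoown f hf T
          (fun j => (Finset.mem_powersetCard.1 (Finset.mem_filter.1 (hTG j)).1).2)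
          (fun j => (Finset.mem_filter.1 (hTG j)).2) h1 h2
  have hO : (P.filter (fun S => IsOwnSubset F A (S.map f))).card ≤
      ((A.powersetCard t).filter (fun T => IsOwnSubset F A T)).card := by
    apply Finset.card_le_card_of_injOn (fun S => S.map f)
    · intro S hS
      obtain ⟨hS1, hS2⟩ := Finset.mem_filter.1 hS
      refine Finset.mem_filter.2 ⟨Finset.mem_powersetCard.2 ⟨hS2.1, ?_⟩, hS2⟩
      rw [Finset.card_map]
      exact (Finset.mem_powersetCard.1 hS1).2
    · exact (Finset.map_injective f).injOn
  have hP : P.card = k.choose t := by simp [P]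
  have hsplit : (P.filter (fun S => IsOwnSubset F A (S.map f))).card + G.card = P.card :=
    Finset.card_filter_add_card_filter_not _
  omega
end

section
/- Let n ≥ k ≥ 2, c ≥ 2, 1 ≤ s ≤ c-1, t = ⌈sk/c⌉, and let λ ∈ [c] satisfy λ ≡ sk (mod c). If n ≥ (binom(k,t) - m(k,t,λ; s+1,c-s+1))·t + t - 1, then every (c,s)-frameproof hypergraph F ⊆ binom([n],k) satisfies |F| ≤ binom(n,t) / (binom(k,t) - m(k,t,λ; s+1,c-s+1)). -/
theorem fp_realize {α : Type*} [Fintype α] [DecidableEq α] (t : ℕ) : ∀ (r : ℕ) (d : α → ℕ),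
    (∀ i, d i ≤ r) → ∑ i, d i = r * t →
    ∃ A : Fin r → Finset α, (∀ j, (A j).card = t) ∧
      ∀ i, (Finset.univ.filter (fun j => i ∈ A j)).card = d i := by
  intro r
  induction r with
  | zero =>
    intro d hd _
    refine ⟨fun _ => ∅, fun j => j.elim0, fun i => ?_⟩
    have := hd i
    simp
    omega
  | succ r ih =>
    intro d hd hsum
    let X : Finset α := Finset.univ.filter (fun i => d i = r + 1)
    let Y : Finset α := Finset.univ.filter (fun i => 0 < d i)
    have hXY : X ⊆ Y := by
      intro i hi
      simp only [X, Y, Finset.mem_filter, Finset.mem_univ, true_and] at *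
      omega
    have hX : X.card ≤ t := by
      have h1 : ∑ i ∈ X, (r + 1) ≤ ∑ i, d i := by
        calc ∑ i ∈ X, (r + 1) = ∑ i ∈ X, d i := by
              apply Finset.sum_congr rfl
              intro i hi
              simp only [X, Finset.mem_filter] at hi
              exact hi.2.symm
          _ ≤ ∑ i, d i := Finset.sum_le_sum_of_subset (Finset.subset_univ _)
      rw [Finset.sum_const, smul_eq_mul, hsum] at h1
      nlinarith
    have hY : t ≤ Y.card := by
      have h1 : ∑ i, d i ≤ ∑ i ∈ Y, (r + 1) := by
        calc ∑ i, d i = ∑ i ∈ Y, d i := by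
              symm
              apply Finset.sum_subset (Finset.subset_univ _)
              intro i _ hi
              simp only [Y, Finset.mem_filter, Finset.mem_univ, true_and] at hi
              omega
          _ ≤ _ := Finset.sum_le_sum (fun i _ => hd i)
      rw [Finset.sum_const, smul_eq_mul, hsum] at h1
      nlinarith
    obtain ⟨Z, hXZ, hZY, hZ⟩ := Finset.exists_subsuperset_card_eq hXY hX hY
    have hpos : ∀ i ∈ Z, 0 < d i := fun i hi => by
      have := hZY hi
      simpa [Y] using this
    have hlt : ∀ i, i ∉ Z → d i ≤ r := fun i hi => by
      have h1 : i ∉ X := fun h => hi (hXZ h)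
      simp only [X, Finset.mem_filter, Finset.mem_univ, true_and] at h1
      have := hd i
      omega
    have hsplit : ∀ i, d i = (d i - if i ∈ Z then 1 else 0) + if i ∈ Z then 1 else 0 := by
      intro i
      split_ifs with h
      · have := hpos i h
        omega
      · omega
    obtain ⟨A, hA1, hA2⟩ := ih (fun i => d i - if i ∈ Z then 1 else 0) (by
      intro i
      have := hd i
      have := hlt i
      try dsimp only
      split_ifs with h
      · omega
      · exact this h) (by
      have h2 : ∑ i, d i = ∑ i, (d i - if i ∈ Z then 1 else 0) + ∑ i, if i ∈ Z then 1 else 0 := by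
        rw [← Finset.sum_add_distrib]
        exact Finset.sum_congr rfl (fun i _ => hsplit i)
      have h3 : (∑ i, if i ∈ Z then 1 else 0) = t := by
        rw [← hZ]
        simp
      rw [h3, hsum] at h2
      have h4 : (r + 1) * t = r * t + t := by ring
      omega)
    refine ⟨Fin.cons Z A, ?_, ?_⟩
    · intro j
      refine Fin.cases ?_ (fun j => ?_) j
      · simpa using hZ
      · simpa using hA1 j
    · intro i
      have h5 := hA2 i
      rw [Finset.card_filter] at h5 ⊢
      rw [Fin.sum_univ_succ]
      simp only [Fin.cons_zero, Fin.cons_succ]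
      rw [h5]
      have := hsplit i
      try dsimp only
      omega

theorem fp_deg (k lo hi : ℕ) (hlh : lo ≤ hi) : ∀ N, k * lo ≤ N → N ≤ k * hi →
    ∃ d : Fin k → ℕ, (∀ i, lo ≤ d i ∧ d i ≤ hi) ∧ ∑ i, d i = N := by
  intro N h
  induction N, h using Nat.le_induction with
  | base => intro _; exact ⟨fun _ => lo, fun _ => ⟨le_rfl, hlh⟩, by simp⟩
  | succ N h ih =>
    intro hN
    obtain ⟨d, hd, hsum⟩ := ih (by omega)
    have : ∃ i, d i < hi := by
      by_contra hcon
      push Not at hcon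
      have : ∑ i : Fin k, hi ≤ ∑ i, d i := Finset.sum_le_sum (fun i _ => hcon i)
      simp at this
      omega
    obtain ⟨i, hi'⟩ := this
    refine ⟨fun j => d j + if j = i then 1 else 0, ?_, ?_⟩
    · intro j
      have := hd j
      dsimp only
      split_ifs with h
      · subst h; omega
      · omega
    · rw [Finset.sum_add_distrib, hsum]; simp

theorem fp_bdd (n t lam k1 k2 : ℕ) : BddAbove {N | ∃ G : Finset (Finset (Fin n)),
    (∀ S ∈ G, S.card = t) ∧
    (¬ ∃ A : Fin lam → Finset (Fin n), (∀ i, A i ∈ G) ∧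
      (∀ B : Finset (Fin lam), B.card = k1 → B.inf A = ∅) ∧
      (∀ B : Finset (Fin lam), B.card = k2 → B.sup A = Finset.univ)) ∧
    G.card = N} := by
  refine ⟨Fintype.card (Finset (Fin n)), ?_⟩
  rintro N ⟨G, _, _, rfl⟩
  exact Finset.card_le_univ G

theorem fp_cond {k lam k1 k2 : ℕ} (A : Fin lam → Finset (Fin k)) :
    ((∀ B : Finset (Fin lam), B.card = k1 + 1 → B.inf A = ∅) ∧
      (∀ B : Finset (Fin lam), B.card = k2 + 1 → B.sup A = Finset.univ)) ↔
    ∀ i, (Finset.univ.filter (fun j => i ∈ A j)).card ≤ k1 ∧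
      lam ≤ (Finset.univ.filter (fun j => i ∈ A j)).card + k2 := by
  have hc : ∀ i, (Finset.univ.filter (fun j => i ∈ A j)).card +
      (Finset.univ.filter (fun j => i ∉ A j)).card = lam := by
    intro i
    rw [Finset.card_filter_add_card_filter_not]
    simp
  constructor
  · rintro ⟨h1, h2⟩ i
    constructor
    · by_contra hcon
      obtain ⟨B, hB, hBc⟩ := Finset.exists_subset_card_eq 
        (show k1 + 1 ≤ (Finset.univ.filter (fun j => i ∈ A j)).card by omega)
      have h3 : i ∈ B.inf A := by
        rw [Finset.mem_inf]
        intro j hj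
        simpa using hB hj
      rw [h1 B hBc] at h3
      simp at h3
    · by_contra hcon
      have := hc i
      obtain ⟨B, hB, hBc⟩ := Finset.exists_subset_card_eq
        (show k2 + 1 ≤ (Finset.univ.filter (fun j => i ∉ A j)).card by omega)
      have h3 : i ∈ B.sup A := by
        rw [h2 B hBc]; simp
      rw [Finset.mem_sup] at h3
      obtain ⟨j, hj, hij⟩ := h3
      have := hB hj
      simp at this
      exact this hij
  · intro h
    constructor
    · intro B hB
      rw [Finset.eq_empty_iff_forall_notMem]
      intro i hi
      rw [Finset.mem_inf] at hi
      have : B ⊆ Finset.univ.filter (fun j => i ∈ A j) := fun j hj => by simpa using hi j hj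
      have := Finset.card_le_card this
      have := (h i).1
      omega
    · intro B hB
      rw [Finset.eq_univ_iff_forall]
      intro i
      by_contra hi
      rw [Finset.mem_sup] at hi
      have : B ⊆ Finset.univ.filter (fun j => i ∉ A j) := fun j hj => by
        simp only [Finset.mem_filter, Finset.mem_univ, true_and]
        exact fun h' => hi ⟨j, hj, h'⟩
      have := Finset.card_le_card this
      have := (h i).2
      have := hc i
      omega

/-- arithmetic: with `c = lam + r`, `t = u + 1`, we have `s k = c u + lam`. -/
theorem fp_arith (k c s t lam : ℕ) (hk : 2 ≤ k)
    (hc : 2 ≤ c) (hs1 : 1 ≤ s) (hs2 : s ≤ c - 1)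
    (ht : t = (s * k + c - 1) / c)
    (hlam1 : 1 ≤ lam) (hlam2 : lam ≤ c) (hmod : lam % c = (s * k) % c) :
    ∃ u, t = u + 1 ∧ s * k = c * u + lam ∧ t ≤ k := by
  have hsk : 1 ≤ s * k := Nat.mul_pos hs1 (by omega)
  have hle : lam ≤ s * k := by
    rcases Nat.lt_or_ge (s * k) c with h | h
    · rw [Nat.mod_eq_of_lt h] at hmod
      rcases Nat.lt_or_ge lam c with h' | h'
      · rw [Nat.mod_eq_of_lt h'] at hmod; omega
      · have : lam = c := by omega
        subst this
        simp at hmod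
        omega
    · omega
  obtain ⟨u, hu⟩ := (Nat.modEq_iff_dvd' hle).1 hmod
  have h1 : s * k = c * u + lam := by omega
  have h2 : t = u + 1 := by
    rw [ht, h1]
    apply Nat.div_eq_of_lt_le
    · have : (u + 1) * c = c * u + c := by ring
      omega
    · have : (u + 1 + 1) * c = c * u + c + c := by ring
      omega
  refine ⟨u, h2, h1, ?_⟩
  have h3 : s * k ≤ c * k := Nat.mul_le_mul_right k (by omega)
  have h4 : c * u < c * k := by omega
  have := Nat.lt_of_mul_lt_mul_left h4
  omega

theorem fp_pos (k c s t lam u : ℕ) (hs2 : s ≤ c) (hlam1 : 1 ≤ lam) (hlam2 : lam ≤ c)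
    (htu : t = u + 1) (hsk : s * k = c * u + lam) (htk : t ≤ k) :
    genMatch k t lam (s + 1) (c - s + 1) < Nat.choose k t := by
  have hne : genMatch k t lam (s + 1) (c - s + 1) ∈ _ := Nat.sSup_mem ⟨0, ∅, by simp, by
    rintro ⟨A, hA, _⟩
    exact absurd (hA ⟨0, hlam1⟩) (by simp), rfl⟩ (fp_bdd k t lam (s + 1) (c - s + 1))
  obtain ⟨G, hG1, hG2, hG3⟩ := hne
  have hsub : G ⊆ Finset.powersetCard t Finset.univ := fun S hS => by
    simp [Finset.mem_powersetCard, hG1 S hS]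
  have hcard : (Finset.powersetCard t (Finset.univ : Finset (Fin k))).card = k.choose t := by
    simp
  have hle := Finset.card_le_card hsub
  rw [hcard, hG3] at hle
  refine lt_of_le_of_ne hle fun heq => hG2 ?_
  have hGe : G = Finset.powersetCard t Finset.univ :=
    Finset.eq_of_subset_of_card_le hsub (by rw [hcard, hG3, heq])
  obtain ⟨r, rfl⟩ := Nat.exists_eq_add_of_le hlam2
  obtain ⟨v, rfl⟩ := Nat.exists_eq_add_of_le htk
  obtain ⟨d, hd, hsum⟩ := fp_deg (t + v) (lam + s - (lam + r)) (min s lam) (by omega) (lam * t)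
    (by
      rcases Nat.le_total r s with h | h
      · obtain ⟨w, rfl⟩ := Nat.exists_eq_add_of_le h
        have : lam + (r + w) - (lam + r) = w := by omega
        rw [this]
        subst htu
        nlinarith [Nat.zero_le (r * v)]
      · have : lam + s - (lam + r) = 0 := by omega
        rw [this]; simp)
    (by
      rcases min_choice s lam with h | h
      · rw [h]; subst htu; nlinarith [Nat.zero_le (r * u)]
      · rw [h]; nlinarith [Nat.zero_le (lam * v)])
  obtain ⟨A, hA1, hA2⟩ := fp_realize t lam d (fun i => by have := hd i; omega) hsum
  refine ⟨A, fun j => ?_, (fp_cond A).2 fun i => ?_⟩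
  · rw [hGe]; simp [Finset.mem_powersetCard, hA1]
  · rw [hA2]
    have := hd i
    omega

theorem fp_key {n : ℕ} (k r s t lam u : ℕ)
    (htu : t = u + 1) (hsk : s * k = (lam + r) * u + lam) (hs2 : s ≤ lam + r)
    (F : Finset (Finset (Fin n))) (hfp : IsFrameproof (lam + r) s F)
    (A : Finset (Fin n)) (hA : A ∈ F) (hAk : A.card = k)
    (hnown : ∀ T ⊆ A, T.card = u → ∃ B ∈ F, B ≠ A ∧ T ⊆ B) :
    Nat.choose k t - genMatch k t lam (s + 1) (lam + r - s + 1) ≤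
      ((Finset.powersetCard t A).filter (fun T => ∀ B ∈ F, T ⊆ B → B = A)).card := by
  classical
  let f : Fin k ↪ Fin n := (A.orderEmbOfFin hAk).toEmbedding
  have hf : ∀ i, f i ∈ A := fun i => Finset.orderEmbOfFin_mem A hAk i
  have hfs : ∀ a ∈ A, ∃ i, f i = a := fun a ha => by
    have := Finset.range_orderEmbOfFin A hAk
    have h2 : a ∈ Set.range (A.orderEmbOfFin hAk) := by rw [this]; exact ha
    exact h2
  have hfA : ∀ S : Finset (Fin k), S.map f ⊆ A := by
    intro S x hx
    obtain ⟨i, _, rfl⟩ := Finset.mem_map.1 hx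
    exact hf i
  let P : Finset (Fin k) → Prop := fun S => ∃ B ∈ F, B ≠ A ∧ S.map f ⊆ B
  let G : Finset (Finset (Fin k)) := (Finset.powersetCard t Finset.univ).filter P
  let H : Finset (Finset (Fin k)) := (Finset.powersetCard t Finset.univ).filter (fun S => ¬ P S)
  have hGH : G.card + H.card = k.choose t := by
    rw [Finset.card_filter_add_card_filter_not]; simp
  have hG : G.card ≤ genMatch k t lam (s + 1) (lam + r - s + 1) := by
    apply le_csSup (fp_bdd _ _ _ _ _)
    refine ⟨G, fun S hS => ?_, ?_, rfl⟩
    · simp only [G, Finset.mem_filter, Finset.mem_powersetCard] at hS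
      exact hS.1.2
    · rintro ⟨A', hA', hcond⟩
      rw [fp_cond] at hcond
      have hA'c : ∀ j, (A' j).card = t := fun j => by
        have := hA' j
        simp only [G, Finset.mem_filter, Finset.mem_powersetCard] at this
        exact this.1.2
      have hA'P : ∀ j, P (A' j) := fun j => (Finset.mem_filter.1 (hA' j)).2
      have hsumd : ∑ i, (Finset.univ.filter (fun j => i ∈ A' j)).card = lam * t := by
        simp only [Finset.card_filter]
        rw [Finset.sum_comm]
        simp [hA'c]
      obtain ⟨C, hC1, hC2⟩ := fp_realize u r
        (fun i => s - (Finset.univ.filter (fun j => i ∈ A' j)).card)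
        (fun i => by have := hcond i; omega)
        (by
          have h1 : ∑ i, (s - (Finset.univ.filter (fun j => i ∈ A' j)).card) +
              ∑ i, (Finset.univ.filter (fun j => i ∈ A' j)).card = k * s := by
            rw [← Finset.sum_add_distrib]
            rw [Finset.sum_congr rfl (fun i _ => Nat.sub_add_cancel (hcond i).1)]
            simp
          rw [hsumd, htu] at h1
          nlinarith)
      have hCP : ∀ j, P (C j) := fun j => hnown _ (hfA _) (by simp [hC1])
      choose E1 hE1 hE1n hE1s using hA'P
      choose E2 hE2 hE2n hE2s using hCP
      obtain ⟨a, ha, hlt⟩ := hfp A hA (Fin.append E1 E2)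
        (fun j => by refine Fin.addCases (fun j => ?_) (fun j => ?_) j <;> simp [hE1, hE2])
        (fun j => by refine Fin.addCases (fun j => ?_) (fun j => ?_) j <;> simp [hE1n, hE2n])
      obtain ⟨i, rfl⟩ := hfs a ha
      rw [Finset.card_filter, Fin.sum_univ_add] at hlt
      simp only [Fin.append_left, Fin.append_right] at hlt
      rw [← Finset.card_filter, ← Finset.card_filter] at hlt
      have h1 : (Finset.univ.filter (fun j => i ∈ A' j)).card ≤
          (Finset.univ.filter (fun j => f i ∈ E1 j)).card := by
        apply Finset.card_le_card
        intro j hj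
        simp only [Finset.mem_filter, Finset.mem_univ, true_and] at *
        exact hE1s j (Finset.mem_map_of_mem f hj)
      have h2 : (Finset.univ.filter (fun j => i ∈ C j)).card ≤
          (Finset.univ.filter (fun j => f i ∈ E2 j)).card := by
        apply Finset.card_le_card
        intro j hj
        simp only [Finset.mem_filter, Finset.mem_univ, true_and] at *
        exact hE2s j (Finset.mem_map_of_mem f hj)
      rw [hC2] at h2
      omega
  have hH : H.card ≤
      ((Finset.powersetCard t A).filter (fun T => ∀ B ∈ F, T ⊆ B → B = A)).card := by
    apply Finset.card_le_card_of_injOn (fun S => S.map f)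
    · intro S hS
      simp only [H, P, Finset.coe_filter, Set.mem_ofPred_eq, Finset.mem_powersetCard] at hS ⊢
      refine ⟨⟨hfA S, by simp [hS.1.2]⟩, fun B hB hSB => ?_⟩
      by_contra hne
      exact hS.2 ⟨B, hB, hne, hSB⟩
    · exact fun S _ S' _ h => Finset.map_injective f h
  omega

theorem fp_count {n : ℕ} (M u : ℕ) (hn : M * (u + 1) + u ≤ n)
    (F : Finset (Finset (Fin n)))
    (h : ∀ A ∈ F, (∃ T ⊆ A, T.card = u ∧ ∀ B ∈ F, T ⊆ B → B = A) ∨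
      M ≤ ((Finset.powersetCard (u + 1) A).filter (fun T => ∀ B ∈ F, T ⊆ B → B = A)).card) :
    F.card * M ≤ n.choose (u + 1) := by
  classical
  let p : Finset (Fin n) → Prop := fun A => ∃ T ⊆ A, T.card = u ∧ ∀ B ∈ F, T ⊆ B → B = A
  let F1 := F.filter p
  let F2 := F.filter (fun A => ¬ p A)
  have hF : F1.card + F2.card = F.card := Finset.card_filter_add_card_filter_not p
  have hch : ∀ A, ∃ T, p A → (T ⊆ A ∧ T.card = u ∧ ∀ B ∈ F, T ⊆ B → B = A) := by
    intro A
    by_cases hA : p A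
    · obtain ⟨T, hT⟩ := hA
      exact ⟨T, fun _ => hT⟩
    · exact ⟨∅, fun h => absurd h hA⟩
  choose T hT using hch
  let all := Finset.powersetCard (u + 1) (Finset.univ : Finset (Fin n))
  let V := all.filter (fun S => ∃ A ∈ F1, T A ⊆ S)
  let U : Finset (Fin n) → Finset (Finset (Fin n)) := fun A =>
    (Finset.powersetCard (u + 1) A).filter (fun T => ∀ B ∈ F, T ⊆ B → B = A)
  let W := F2.biUnion U
  have hW : F2.card * M ≤ W.card := by
    rw [Finset.card_biUnion]
    · rw [← smul_eq_mul]
      apply Finset.card_nsmul_le_sum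
      intro A hA
      have hA' := Finset.mem_filter.1 hA
      exact (h A hA'.1).resolve_left hA'.2
    · intro A hA B hB hne
      change Disjoint (U A) (U B)
      rw [Finset.disjoint_left]
      intro S hS hS'
      simp only [U, Finset.mem_filter, Finset.mem_powersetCard] at hS hS'
      exact hne (hS'.2 A (Finset.mem_filter.1 hA).1 hS.1.1)
  have hV : F1.card * M ≤ V.card := by
    have h1 : F1.card * (n - u) ≤ V.card * (u + 1) := by
      apply Finset.card_mul_le_card_mul (fun A S => T A ⊆ S)
      · intro A hA
        obtain ⟨hTA, hTc, hTo⟩ := hT A (Finset.mem_filter.1 hA).2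
        have h2 : ((T A)ᶜ.image (fun x => insert x (T A))).card = n - u := by
          rw [Finset.card_image_of_injOn, Finset.card_compl, hTc, Fintype.card_fin]
          intro x hx y hy hxy
          simp only [Finset.coe_compl, Set.mem_compl_iff, Finset.mem_coe] at hx hy
          dsimp only at hxy
          have : x ∈ insert y (T A) := by rw [← hxy]; simp
          simpa [hx] using this
        rw [← h2]
        apply Finset.card_le_card
        intro S hS
        obtain ⟨x, hx, rfl⟩ := Finset.mem_image.1 hS
        simp only [Finset.mem_compl] at hx
        rw [Finset.mem_bipartiteAbove]
        refine ⟨Finset.mem_filter.2 ⟨?_, A, hA, Finset.subset_insert _ _⟩, Finset.subset_insert _ _⟩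
        simp [all, Finset.mem_powersetCard, Finset.card_insert_of_notMem hx, hTc]
      · intro S hS
        have hSc : S.card = u + 1 := by
          have := (Finset.mem_filter.1 hS).1
          simpa [all, Finset.mem_powersetCard] using this
        have h3 : (Finset.powersetCard u S).card = u + 1 := by
          rw [Finset.card_powersetCard, hSc]; simp
        rw [← h3]
        apply Finset.card_le_card_of_injOn T
        · intro A hA
          simp only [Finset.mem_coe, Finset.mem_bipartiteBelow] at hA
          have := hT A (Finset.mem_filter.1 hA.1).2
          simp only [Finset.mem_coe, Finset.mem_powersetCard]
          exact ⟨hA.2, this.2.1⟩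
        · intro A hA B hB hAB
          simp only [Finset.mem_coe, Finset.mem_bipartiteBelow] at hA hB
          have hA1 := Finset.mem_filter.1 hA.1
          have hB1 := Finset.mem_filter.1 hB.1
          apply (hT B hB1.2).2.2 A hA1.1
          rw [← hAB]
          exact (hT A hA1.2).1
    have h4 : M * (u + 1) ≤ n - u := by omega
    have h5 : F1.card * (M * (u + 1)) ≤ F1.card * (n - u) := Nat.mul_le_mul_left _ h4
    have h6 : (F1.card * M) * (u + 1) ≤ V.card * (u + 1) := by
      rw [mul_assoc]; exact h5.trans h1
    exact Nat.le_of_mul_le_mul_right h6 (Nat.succ_pos u)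
  have hdisj : Disjoint V W := by
    rw [Finset.disjoint_left]
    intro S hS hS'
    obtain ⟨_, A, hA, hTS⟩ := Finset.mem_filter.1 hS
    obtain ⟨B, hB, hSB⟩ := Finset.mem_biUnion.1 hS'
    simp only [U, Finset.mem_filter, Finset.mem_powersetCard] at hSB
    have hA1 := Finset.mem_filter.1 hA
    have hB1 := Finset.mem_filter.1 hB
    have : B = A := (hT A hA1.2).2.2 B hB1.1 (hTS.trans hSB.1.1)
    subst this
    exact hB1.2 hA1.2
  have hsub : V ∪ W ⊆ all := by
    apply Finset.union_subset (Finset.filter_subset _ _)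
    intro S hS
    obtain ⟨B, hB, hSB⟩ := Finset.mem_biUnion.1 hS
    simp only [U, Finset.mem_filter, Finset.mem_powersetCard] at hSB
    simp [all, Finset.mem_powersetCard, hSB.1.2]
  have h7 := Finset.card_le_card hsub
  rw [Finset.card_union_of_disjoint hdisj] at h7
  have h8 : all.card = n.choose (u + 1) := by simp [all]
  rw [← hF, add_mul]
  omega

/-- For n ≥ k ≥ 2, c ≥ 2, 1 ≤ s ≤ c-1, t = ⌈sk/c⌉, λ ∈ [c] with
λ ≡ sk (mod c), and n ≥ (binom(k,t) - m(k,t,λ;s+1,c-s+1))·t + t - 1, every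
(c,s)-frameproof hypergraph F ⊆ binom([n],k) satisfies
|F| ≤ binom(n,t) / (binom(k,t) - m(k,t,λ;s+1,c-s+1)). -/
theorem stmt6 (n k c s t lam : ℕ) (hnk : k ≤ n) (hk : 2 ≤ k)
    (hc : 2 ≤ c) (hs1 : 1 ≤ s) (hs2 : s ≤ c - 1)
    (ht : t = (s * k + c - 1) / c)
    (hlam1 : 1 ≤ lam) (hlam2 : lam ≤ c) (hmod : lam % c = (s * k) % c)
    (hn : (Nat.choose k t - genMatch k t lam (s + 1) (c - s + 1)) * t + t - 1 ≤ n)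
    (F : Finset (Finset (Fin n))) (huniform : ∀ A ∈ F, A.card = k)
    (hfp : IsFrameproof c s F) :
    (F.card : ℝ) ≤ (Nat.choose n t : ℝ) /
      ((Nat.choose k t - genMatch k t lam (s + 1) (c - s + 1) : ℕ) : ℝ) := by
  obtain ⟨u, htu, hsk, htk⟩ := fp_arith k c s t lam hk hc hs1 hs2 ht hlam1 hlam2 hmod
  have hpos := fp_pos k c s t lam u (by omega) hlam1 hlam2 htu hsk htk
  have hmain : F.card * (Nat.choose k t - genMatch k t lam (s + 1) (c - s + 1)) ≤ n.choose t := by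
    rw [htu] at hn ⊢
    apply fp_count _ u (by omega) F
    intro A hA
    by_cases hp : ∃ T ⊆ A, T.card = u ∧ ∀ B ∈ F, T ⊆ B → B = A
    · exact Or.inl hp
    · right
      obtain ⟨r, rfl⟩ := Nat.exists_eq_add_of_le hlam2
      apply fp_key k r s (u + 1) lam u rfl hsk (by omega) F hfp A hA (huniform A hA)
      intro T hTA hTu
      by_contra hcon
      refine hp ⟨T, hTA, hTu, fun B hB hTB => ?_⟩
      by_contra hne
      exact hcon ⟨B, hB, hne, hTB⟩
  rw [le_div_iff₀ (by exact_mod_cast Nat.sub_pos_of_lt hpos)]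
  exact_mod_cast hmain
end
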